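/- Let X = (x_1, …, x_n) be points in ℝ^d with sample mean x̄ and marginal empirical variances σ̂_k² = (1/n) ∑_{i=1}^n (x_{i,k} − x̄_k)² for k = 1, …, d, all assumed positive, and let the bandwidth assignment be H_X = h² diag(σ̂_1², …, σ̂_d²) for some h > 0. If A = diag(a_1, …, a_d) with all a_k ≠ 0 and b ∈ ℝ^d, then H_{AX+b} = h² diag(a_1² σ̂_1², …, a_d² σ̂_d²) = A H_X Aᵀ, and for every y ∈ ℝ^d the kernel potential estimate satisfies φ_{AX+b, H_{AX+b}}(A y + b) = (∏_{k=1}^d |a_k|)^{−1} · φ_{X, H_X}(y); i.e., the potential is invariant under componentwise scaling up to the factor |det A|^{−1}. -/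

import Mathlib

open Matrix

/-- The kernel potential estimate of the data cloud `x` at the point `y`, with symmetric
positive definite bandwidth matrix `H` and spherical kernel `K(z) = r (zᵀ z)`:
`φ_{X,H}(y) = (1/n) ∑ᵢ det(H)^{-1/2} r((y - xᵢ)ᵀ H⁻¹ (y - xᵢ))`. -/
noncomputable def potential {d n : ℕ} (x : Fin n → (Fin d → ℝ))
    (H : Matrix (Fin d) (Fin d) ℝ) (r : ℝ → ℝ) (y : Fin d → ℝ) : ℝ :=
  (n : ℝ)⁻¹ * ∑ i : Fin n, H.det ^ (-(1 : ℝ) / 2) * r ((y - x i) ⬝ᵥ (H⁻¹ *ᵥ (y - x i)))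

/-- The sample mean `x̄ = (1/n) ∑ᵢ xᵢ` of a data cloud in `ℝ^d`. -/
noncomputable def sampleMean {d n : ℕ} (x : Fin n → (Fin d → ℝ)) : Fin d → ℝ :=
  (n : ℝ)⁻¹ • ∑ i : Fin n, x i

/-- The `k`-th marginal empirical variance `σ̂ₖ² = (1/n) ∑ᵢ (x_{i,k} - x̄ₖ)²`. -/
noncomputable def margVar {d n : ℕ} (x : Fin n → (Fin d → ℝ)) (k : Fin d) : ℝ :=
  (n : ℝ)⁻¹ * ∑ i : Fin n, (x i k - sampleMean x k) ^ 2

/-- Affine maps act on the sample mean. -/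
lemma sampleMean_mulVec_add {d n : ℕ} (hn : 0 < n) (x : Fin n → (Fin d → ℝ))
    (A : Matrix (Fin d) (Fin d) ℝ) (b : Fin d → ℝ) :
    sampleMean (fun i => A *ᵥ x i + b) = A *ᵥ sampleMean x + b := by
  have hn' : (n : ℝ) ≠ 0 := by exact_mod_cast hn.ne'
  have hsum : ∑ i : Fin n, A *ᵥ x i = A *ᵥ ∑ i : Fin n, x i :=
    (map_sum A.mulVecLin x Finset.univ).symm
  unfold sampleMean
  rw [Finset.sum_add_distrib, hsum, Finset.sum_const, Finset.card_univ, Fintype.card_fin,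
    ← Nat.cast_smul_eq_nsmul ℝ, smul_add, smul_smul, inv_mul_cancel₀ hn', one_smul,
    Matrix.mulVec_smul]

/-- A componentwise scaling by `a` multiplies the `k`-th marginal variance by `aₖ²`. -/
lemma margVar_diagonal_mulVec_add {d n : ℕ} (hn : 0 < n) (x : Fin n → (Fin d → ℝ))
    (a b : Fin d → ℝ) (k : Fin d) :
    margVar (fun i => Matrix.diagonal a *ᵥ x i + b) k = a k ^ 2 * margVar x k := by
  unfold margVar
  rw [sampleMean_mulVec_add hn, mul_left_comm]
  congr 1
  rw [Finset.mul_sum]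
  refine Finset.sum_congr rfl fun i _ => ?_
  simp only [Pi.add_apply, Matrix.mulVec_diagonal]
  ring

/-- If the bandwidth matrix transforms as `H ↦ A H Aᵀ`, the potential is invariant under the
affine map `z ↦ A z + b` up to the factor `|det A|⁻¹`. -/
lemma potential_mulVec_add {d n : ℕ} (x : Fin n → (Fin d → ℝ))
    (A H : Matrix (Fin d) (Fin d) ℝ) (hA : IsUnit A.det) (hH : 0 ≤ H.det)
    (b : Fin d → ℝ) (r : ℝ → ℝ) (y : Fin d → ℝ) :
    potential (fun i => A *ᵥ x i + b) (A * H * Aᵀ) r (A *ᵥ y + b)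
      = |A.det|⁻¹ * potential x H r y := by
  have hdet : (A * H * Aᵀ).det ^ (-(1 : ℝ) / 2) = |A.det|⁻¹ * H.det ^ (-(1 : ℝ) / 2) := by
    have hmul : (A * H * Aᵀ).det = |A.det| ^ (2 : ℝ) * H.det := by
      rw [Matrix.det_mul, Matrix.det_mul, Matrix.det_transpose, Real.rpow_two, sq_abs]
      ring
    rw [hmul, Real.mul_rpow (by positivity) hH, ← Real.rpow_mul (abs_nonneg _),
      show (2 : ℝ) * (-1 / 2) = -1 by norm_num, Real.rpow_neg_one]
  have hquad (v : Fin d → ℝ) :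
      (A *ᵥ v) ⬝ᵥ ((A * H * Aᵀ)⁻¹ *ᵥ (A *ᵥ v)) = v ⬝ᵥ (H⁻¹ *ᵥ v) := by
    have hAt : IsUnit Aᵀ.det := by rwa [Matrix.det_transpose]
    rw [Matrix.mul_inv_rev, Matrix.mul_inv_rev, Matrix.mulVec_mulVec, Matrix.mul_assoc,
      Matrix.mul_assoc, Matrix.nonsing_inv_mul A hA, Matrix.mul_one, ← Matrix.vecMul_transpose,
      ← Matrix.dotProduct_mulVec, Matrix.mulVec_mulVec, ← Matrix.mul_assoc,
      Matrix.mul_nonsing_inv Aᵀ hAt, Matrix.one_mul]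
  unfold potential
  rw [mul_left_comm]
  congr 1
  rw [Finset.mul_sum]
  refine Finset.sum_congr rfl fun i _ => ?_
  rw [add_sub_add_right_eq_sub, ← Matrix.mulVec_sub, hdet, hquad, mul_assoc]

/-- For the bandwidth assignment `H_X = h² diag(σ̂₁², …, σ̂_d²)` built from the marginal
empirical variances, a componentwise scaling `A = diag(a₁, …, a_d)` (all `aₖ ≠ 0`) and a shift
`b` satisfy `H_{AX+b} = h² diag(a₁²σ̂₁², …, a_d²σ̂_d²) = A H_X Aᵀ`, and the kernel potential
estimate is invariant under componentwise scaling up to the factor `(∏ₖ |aₖ|)⁻¹ = |det A|⁻¹`. -/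
theorem potential_componentwise_scaling_invariant {d n : ℕ} (hn : 0 < n)
    (x : Fin n → (Fin d → ℝ)) (h : ℝ) (hh : 0 < h)
    (hvar : ∀ k, 0 < margVar x k)
    (a : Fin d → ℝ) (ha : ∀ k, a k ≠ 0) (b : Fin d → ℝ)
    (r : ℝ → ℝ) (hr0 : ∀ t, 0 ≤ r t) (hrmono : AntitoneOn r (Set.Ici 0))
    (hrbdd : ∃ M, ∀ t, r t ≤ M) :
    h ^ 2 • Matrix.diagonal (margVar (fun i => Matrix.diagonal a *ᵥ x i + b))
        = h ^ 2 • Matrix.diagonal (fun k => a k ^ 2 * margVar x k) ∧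
    h ^ 2 • Matrix.diagonal (margVar (fun i => Matrix.diagonal a *ᵥ x i + b))
        = Matrix.diagonal a * (h ^ 2 • Matrix.diagonal (margVar x)) * (Matrix.diagonal a)ᵀ ∧
    ∀ y : Fin d → ℝ,
      potential (fun i => Matrix.diagonal a *ᵥ x i + b)
          (h ^ 2 • Matrix.diagonal (margVar (fun i => Matrix.diagonal a *ᵥ x i + b))) r
          (Matrix.diagonal a *ᵥ y + b)
        = (∏ k : Fin d, |a k|)⁻¹ *
            potential x (h ^ 2 • Matrix.diagonal (margVar x)) r y := by
  have hV : margVar (fun i => Matrix.diagonal a *ᵥ x i + b) = fun k => a k ^ 2 * margVar x k :=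
    funext (margVar_diagonal_mulVec_add hn x a b)
  have hconj : h ^ 2 • Matrix.diagonal (margVar (fun i => Matrix.diagonal a *ᵥ x i + b))
      = Matrix.diagonal a * (h ^ 2 • Matrix.diagonal (margVar x)) * (Matrix.diagonal a)ᵀ := by
    rw [hV, Matrix.diagonal_transpose, Matrix.mul_smul, Matrix.smul_mul,
      Matrix.diagonal_mul_diagonal, Matrix.diagonal_mul_diagonal]
    congr 2
    funext k
    ring
  refine ⟨by rw [hV], hconj, fun y => ?_⟩
  have hA : IsUnit (Matrix.diagonal a).det := by
    rw [Matrix.det_diagonal, isUnit_iff_ne_zero]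
    exact Finset.prod_ne_zero_iff.mpr fun k _ => ha k
  have hH : 0 ≤ (h ^ 2 • Matrix.diagonal (margVar x)).det := by
    rw [Matrix.det_smul, Matrix.det_diagonal]
    exact mul_nonneg (by positivity) (Finset.prod_nonneg fun k _ => (hvar k).le)
  rw [hconj, potential_mulVec_add x _ _ hA hH b r y, Matrix.det_diagonal, Finset.abs_prod]
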